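/- arXiv:1710.11078 — 6 statements merged into one kernel-verified Lean document; each statement's English description precedes it below -/
import Mathlib

section
/- Let M : ℝⁿ → (n×n real symmetric matrices) be differentiable, and let q : ℝ → ℝⁿ be differentiable at t₀ with velocity v := q'(t₀). Write Ṁ for the derivative at t₀ of t ↦ M(q(t)), and let f : ℝⁿ → ℝ be f(x) := (1/2)⟨v, M(x) v⟩. Then there exists a skew-symmetric n×n matrix S (the gyroscopic-force matrix S_L) such that −∇f(q(t₀)) = (S − (1/2) Ṁ) v, where ∇f denotes the gradient of f with respect to the standard inner product. -/
open Matrix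

/-- A vector orthogonal to `v` (and zero if `v` is) is the image of `v` under a skew-symmetric
matrix. -/
theorem exists_transpose_eq_neg_mulVec_eq {ι : Type*} [Fintype ι] {v w : ι → ℝ}
    (hvw : w ⬝ᵥ v = 0) (hv : v = 0 → w = 0) :
    ∃ S : Matrix ι ι ℝ, Sᵀ = -S ∧ S *ᵥ v = w := by
  by_cases h : v = 0
  · exact ⟨0, by simp, by simp [hv h]⟩
  · have hvv : v ⬝ᵥ v ≠ 0 := fun h0 => h (dotProduct_self_eq_zero.mp h0)
    refine ⟨(v ⬝ᵥ v)⁻¹ • (vecMulVec w v - vecMulVec v w), ?_, ?_⟩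
    · rw [transpose_smul, transpose_sub, transpose_vecMulVec, transpose_vecMulVec, ← smul_neg,
        neg_sub]
    · rw [smul_mulVec, sub_mulVec, vecMulVec_mulVec, vecMulVec_mulVec, hvw]
      ext i
      simp only [zero_smul, MulOpposite.op_zero, sub_zero, Pi.smul_apply, MulOpposite.smul_eq_mul_unop,
        MulOpposite.unop_op, smul_eq_mul]
      field_simp

/-- The derivative of a quadratic form with fixed argument is the quadratic form of the
entrywise derivative. -/
theorem hasDerivAt_dotProduct_mulVec {ι : Type*} [Fintype ι] {A : ℝ → Matrix ι ι ℝ}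
    {A' : Matrix ι ι ℝ} {t : ℝ} (hA : ∀ i j, HasDerivAt (fun s => A s i j) (A' i j) t)
    (v : ι → ℝ) : HasDerivAt (fun s => v ⬝ᵥ A s *ᵥ v) (v ⬝ᵥ A' *ᵥ v) t := by
  simp only [dotProduct, mulVec]
  exact HasDerivAt.fun_sum fun i _ =>
    (HasDerivAt.fun_sum fun j _ => (hA i j).mul_const (v j)).const_mul (v i)

/-- Arimoto's identity: the gradient of `x ↦ (1/2)⟨v, M(x)v⟩` along a trajectory can be
written as `−(S − (1/2)Ṁ) v` for some skew-symmetric (gyroscopic) matrix `S`. -/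
theorem stmt_1 (n : ℕ) (M : EuclideanSpace ℝ (Fin n) → Matrix (Fin n) (Fin n) ℝ)
    (hMdiff : ∀ i j, Differentiable ℝ (fun x => M x i j))
    (hMsymm : ∀ x, (M x)ᵀ = M x)
    (q : ℝ → EuclideanSpace ℝ (Fin n)) (t₀ : ℝ) (v : EuclideanSpace ℝ (Fin n))
    (hq : HasDerivAt q v t₀)
    (Mdot : Matrix (Fin n) (Fin n) ℝ)
    (hMdot : ∀ i j, HasDerivAt (fun t => M (q t) i j) (Mdot i j) t₀)
    (f : EuclideanSpace ℝ (Fin n) → ℝ)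
    (hf : f = fun x => (1 / 2 : ℝ) * ((v : Fin n → ℝ) ⬝ᵥ (M x).mulVec (v : Fin n → ℝ))) :
    ∃ S : Matrix (Fin n) (Fin n) ℝ, Sᵀ = -S ∧
      -gradient f (q t₀) = (S - (1 / 2 : ℝ) • Mdot).mulVec (v : Fin n → ℝ) := by
  have hfd : DifferentiableAt ℝ f (q t₀) := by
    subst hf
    simp only [dotProduct, mulVec]
    fun_prop
  have hchain : inner ℝ (gradient f (q t₀)) v = (1 / 2 : ℝ) * (v.ofLp ⬝ᵥ Mdot *ᵥ v.ofLp) := by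
    have hcomp : HasDerivAt (f ∘ q) (inner ℝ (gradient f (q t₀)) v) t₀ := by
      simpa using hfd.hasGradientAt.hasFDerivAt.comp_hasDerivAt t₀ hq
    refine hcomp.unique ?_
    subst hf
    exact (hasDerivAt_dotProduct_mulVec hMdot v.ofLp).const_mul _
  have horth : ((1 / 2 : ℝ) • Mdot *ᵥ v.ofLp - (gradient f (q t₀)).ofLp) ⬝ᵥ v.ofLp = 0 := by
    have hinner : (gradient f (q t₀)).ofLp ⬝ᵥ v.ofLp = inner ℝ (gradient f (q t₀)) v := by
      rw [EuclideanSpace.inner_eq_star_dotProduct, star_trivial, dotProduct_comm]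
    rw [sub_dotProduct, hinner, hchain, smul_dotProduct, dotProduct_comm, smul_eq_mul, sub_self]
  obtain ⟨S, hS, hSv⟩ := exists_transpose_eq_neg_mulVec_eq horth (by
    intro hv
    have hf0 : f = fun _ => 0 := by simp [hf, hv]
    simp [hf0, hv])
  refine ⟨S, hS, ?_⟩
  rw [sub_mulVec, hSv, smul_mulVec]
  simp
end

section
/- (Lemma 1, Euclidean version.) Let N, m ∈ ℕ. Let Π : ℝ → (N×N real matrices) be differentiable with Π(t) symmetric positive definite for all t; let Ξ, Υ : ℝ → (N×N real matrices) with Ξ(t) skew-symmetric and Υ(t) symmetric for all t; let Ψ : ℝ → (N×m real matrices). Let δx : ℝ → ℝᴺ be differentiable and δω : ℝ → ℝᵐ satisfy, for all t, δx'(t) = (Ξ(t) − Υ(t)) Π(t) δx(t) + Ψ(t) δω(t). Assume the dissipation condition ⟨δx(t), (Π'(t) − 2 Π(t) Υ(t) Π(t)) δx(t)⟩ ≤ 0 for all t. Then the differential storage function V(t) := (1/2)⟨δx(t), Π(t) δx(t)⟩ is differentiable and satisfies the differential passivity inequality V'(t) ≤ ⟨δy(t), δω(t)⟩ for all t, where δy(t)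 := Ψ(t)ᵀ Π(t) δx(t). -/
open Matrix

/-- The quadratic form of a skew-symmetric matrix vanishes. -/
theorem dotProduct_mulVec_self_eq_zero_of_transpose_eq_neg {n : Type*} [Fintype n]
    {A : Matrix n n ℝ} (hA : Aᵀ = -A) (v : n → ℝ) : v ⬝ᵥ A *ᵥ v = 0 := by
  have h : v ⬝ᵥ A *ᵥ v = -(v ⬝ᵥ A *ᵥ v) := by
    conv_lhs => rw [dotProduct_mulVec, ← mulVec_transpose, hA, neg_mulVec, neg_dotProduct,
      dotProduct_comm]
  linarith

/-- A symmetric matrix can be moved across the dot product. -/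
theorem dotProduct_mulVec_comm_of_transpose_eq {n : Type*} [Fintype n]
    {A : Matrix n n ℝ} (hA : Aᵀ = A) (v w : n → ℝ) : v ⬝ᵥ A *ᵥ w = w ⬝ᵥ A *ᵥ v := by
  rw [dotProduct_mulVec, ← mulVec_transpose, hA, dotProduct_comm]

/-- Product rule for the dot product of two curves. -/
theorem HasDerivAt.dotProduct {n : Type*} [Fintype n] {u v : ℝ → n → ℝ} {u' v' : n → ℝ} {t : ℝ}
    (hu : HasDerivAt u u' t) (hv : HasDerivAt v v' t) :
    HasDerivAt (fun s => u s ⬝ᵥ v s) (u' ⬝ᵥ v t + u t ⬝ᵥ v') t := by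
  rw [hasDerivAt_pi] at hu hv
  simp only [_root_.dotProduct, ← Finset.sum_add_distrib]
  exact HasDerivAt.fun_sum fun i _ => (hu i).fun_mul (hv i)

/-- Product rule for an entrywise differentiable matrix acting on a curve. -/
theorem HasDerivAt.matrix_mulVec {m n : Type*} [Fintype m] [Fintype n]
    {A : ℝ → Matrix m n ℝ} {A' : Matrix m n ℝ} {v : ℝ → n → ℝ} {v' : n → ℝ} {t : ℝ}
    (hA : ∀ i j, HasDerivAt (fun s => A s i j) (A' i j) t) (hv : HasDerivAt v v' t) :
    HasDerivAt (fun s => A s *ᵥ v s) (A' *ᵥ v t + A t *ᵥ v') t :=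
  hasDerivAt_pi.2 fun i => (hasDerivAt_pi.2 (hA i)).dotProduct hv

/-- Lemma 1 (Euclidean version): if the variational dynamics have the form
`δx' = (Ξ − Υ)Pm δx + Ψ δω` with `Ξ` skew, `Υ` symmetric, `Π` a metric and
`Pm' − 2ΠΥPm ≤ 0` along trajectories, then `V = (1/2)δxᵀΠδx` is a differential storage
function: `V' ≤ ⟨δy, δω⟩` with `δy = ΨᵀΠδx`. -/
theorem stmt_4 (N m : ℕ)
    (Pm Pm' : ℝ → Matrix (Fin N) (Fin N) ℝ)
    (hPmdiff : ∀ t i j, HasDerivAt (fun s => Pm s i j) (Pm' t i j) t)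
    (hPmsymm : ∀ t, (Pm t)ᵀ = Pm t)
    (hPmpos : ∀ t (z : Fin N → ℝ), z ≠ 0 → 0 < z ⬝ᵥ (Pm t).mulVec z)
    (Ξ Υ : ℝ → Matrix (Fin N) (Fin N) ℝ)
    (hΞ : ∀ t, (Ξ t)ᵀ = -(Ξ t)) (hΥ : ∀ t, (Υ t)ᵀ = Υ t)
    (Ψ : ℝ → Matrix (Fin N) (Fin m) ℝ)
    (δx : ℝ → Fin N → ℝ) (δω : ℝ → Fin m → ℝ)
    (hdyn : ∀ t, HasDerivAt δx
      ((Ξ t - Υ t).mulVec ((Pm t).mulVec (δx t)) + (Ψ t).mulVec (δω t)) t)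
    (hdiss : ∀ t, δx t ⬝ᵥ (Pm' t - 2 • ((Pm t) * (Υ t) * (Pm t))).mulVec (δx t) ≤ 0)
    (V : ℝ → ℝ) (hV : V = fun t => (1 / 2 : ℝ) * (δx t ⬝ᵥ (Pm t).mulVec (δx t)))
    (δy : ℝ → Fin m → ℝ) (hδy : δy = fun t => (Ψ t)ᵀ.mulVec ((Pm t).mulVec (δx t))) :
    ∀ t, DifferentiableAt ℝ V t ∧ deriv V t ≤ δy t ⬝ᵥ δω t := by
  intro t
  subst hV hδy
  have hderiv := ((hdyn t).dotProduct (.matrix_mulVec (hPmdiff t) (hdyn t))).const_mul (1 / 2 : ℝ)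
  refine ⟨hderiv.differentiableAt, ?_⟩
  rw [hderiv.deriv, dotProduct_add, dotProduct_mulVec_comm_of_transpose_eq (hPmsymm t) (δx t),
    add_dotProduct, sub_mulVec, sub_dotProduct]
  have hskew := dotProduct_mulVec_self_eq_zero_of_transpose_eq_neg (hΞ t) (Pm t *ᵥ δx t)
  have hout : (Ψ t)ᵀ *ᵥ (Pm t *ᵥ δx t) ⬝ᵥ δω t = Ψ t *ᵥ δω t ⬝ᵥ Pm t *ᵥ δx t := by
    rw [mulVec_transpose, ← dotProduct_mulVec, dotProduct_comm]
  have hquad : δx t ⬝ᵥ (Pm t * Υ t * Pm t) *ᵥ δx t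
      = Υ t *ᵥ (Pm t *ᵥ δx t) ⬝ᵥ Pm t *ᵥ δx t := by
    rw [← mulVec_mulVec, ← mulVec_mulVec,
      dotProduct_mulVec_comm_of_transpose_eq (hPmsymm t)]
  have hd := hdiss t
  rw [sub_mulVec, dotProduct_sub, smul_mulVec, dotProduct_smul, hquad, nsmul_eq_mul] at hd
  rw [dotProduct_comm] at hskew
  push_cast at hd
  simp only [hout]
  linarith
end

section
/- (Lemma 2, closed-loop error dynamics for the fully actuated mechanical system.) Let M : ℝⁿ → (n×n real matrices) be C¹ with M(x) invertible for all x, P : ℝⁿ → ℝ be C¹, and let D, E : ℝ → (n×n real matrices), K_d an n×n matrix, φ, η : ℝⁿ → ℝⁿ, ω : ℝ → ℝⁿ, and a C² desired trajectory q_d : ℝ → ℝⁿ. Let q, p : ℝ → ℝⁿ be differentiable; define the position error q̃(t) := q(t) − q_d(t), the auxiliary momentum reference p_r(t) := M(q(t)) (q_d'(t) − φ(q̃(t))), and σ(t) := p(t) − p_r(t), and assume p_r is differentiable. Suppose (q,p) satisfies, for all t, q'(t) = M(q(t))⁻¹ p(t) and p'(t) = −∇P(q(t)) − (E(t) + D(t))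 M(q(t))⁻¹ p(t) + u(t), with the control law u(t) := p_r'(t) + ∇P(q(t)) + (E(t) + D(t)) M(q(t))⁻¹ p_r(t) − η(q̃(t)) − K_d M(q(t))⁻¹ σ(t) + ω(t). Then for all t the error coordinates satisfy q̃'(t) = −φ(q̃(t)) + M(q(t))⁻¹ σ(t) and σ'(t) = −η(q̃(t)) − (E(t) + D(t) + K_d) M(q(t))⁻¹ σ(t) + ω(t). -/
open Matrix

/-- Lemma 2: closed-loop error dynamics of the fully actuated mechanical pH system under
the composite tracking controller `u = u_ff + u_fb`. -/
theorem stmt_8 (n : ℕ)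
    (M : (Fin n → ℝ) → Matrix (Fin n) (Fin n) ℝ)
    (hMC1 : ∀ i j, ContDiff ℝ 1 (fun x => M x i j)) (hMinv : ∀ x, IsUnit (M x))
    (P : (Fin n → ℝ) → ℝ) (hP : ContDiff ℝ 1 P)
    -- `gradP` is the gradient of `P` w.r.t. the standard inner product:
    (gradP : (Fin n → ℝ) → (Fin n → ℝ))
    (hgradP : ∀ x w, fderiv ℝ P x w = gradP x ⬝ᵥ w)
    (D E : ℝ → Matrix (Fin n) (Fin n) ℝ) (Kd : Matrix (Fin n) (Fin n) ℝ)
    (φ η : (Fin n → ℝ) → (Fin n → ℝ)) (ω : ℝ → Fin n → ℝ)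
    (qd : ℝ → Fin n → ℝ) (hqd : ContDiff ℝ 2 qd)
    (q p : ℝ → Fin n → ℝ) (hq : Differentiable ℝ q) (hp : Differentiable ℝ p)
    (qtil : ℝ → Fin n → ℝ) (hqtil : qtil = fun t => q t - qd t)
    (pr : ℝ → Fin n → ℝ)
    (hpr : pr = fun t => (M (q t)).mulVec (deriv qd t - φ (qtil t)))
    (hprdiff : Differentiable ℝ pr)
    (σ : ℝ → Fin n → ℝ) (hσ : σ = fun t => p t - pr t)
    (u : ℝ → Fin n → ℝ)
    (hu : u = fun t => deriv pr t + gradP (q t)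
      + (E t + D t).mulVec ((M (q t))⁻¹.mulVec (pr t))
      - η (qtil t) - Kd.mulVec ((M (q t))⁻¹.mulVec (σ t)) + ω t)
    (hqdyn : ∀ t, HasDerivAt q ((M (q t))⁻¹.mulVec (p t)) t)
    (hpdyn : ∀ t, HasDerivAt p
      (-gradP (q t) - (E t + D t).mulVec ((M (q t))⁻¹.mulVec (p t)) + u t) t) :
    ∀ t, HasDerivAt qtil (-φ (qtil t) + (M (q t))⁻¹.mulVec (σ t)) t ∧
      HasDerivAt σ
        (-η (qtil t) - (E t + D t + Kd).mulVec ((M (q t))⁻¹.mulVec (σ t)) + ω t) t := by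
  intro t
  have hσt : σ t = p t - pr t := congrFun hσ t
  have hprt : (M (q t))⁻¹.mulVec (pr t) = deriv qd t - φ (qtil t) := by
    rw [congrFun hpr t, mulVec_mulVec,
      nonsing_inv_mul _ ((isUnit_iff_isUnit_det _).mp (hMinv (q t))), one_mulVec]
  have hqd' : HasDerivAt qd (deriv qd t) t :=
    (hqd.differentiable two_ne_zero t).hasDerivAt
  constructor
  · have hderiv : HasDerivAt qtil ((M (q t))⁻¹.mulVec (p t) - deriv qd t) t :=
      hqtil ▸ (hqdyn t).sub hqd'
    convert hderiv using 1
    rw [hσt, mulVec_sub, hprt]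
    abel
  · have hderiv : HasDerivAt σ (-gradP (q t)
        - (E t + D t).mulVec ((M (q t))⁻¹.mulVec (p t)) + u t - deriv pr t) t :=
      hσ ▸ (hpdyn t).sub (hprdiff t).hasDerivAt
    convert hderiv using 1
    rw [congrFun hu t, hσt]
    simp only [mulVec_sub, add_mulVec]
    abel
end

section
/- (Corollary 2, exponential tracking rate for the flexible-joint robot.) Under the setup of the coupled variational error dynamics of Proposition 1 with external input δω ≡ 0, strengthen the hypotheses as follows: there are constants β_ℓ, β_m > 0 with ⟨z, (Π_•'(t) − Π_•(t) A_•(t) − A_•(t)ᵀ Π_•(t)) z⟩ ≤ −2β_• ⟨z, Π_•(t) z⟩ for all z and t (• ∈ {ℓ, m}); and there are constants d_ℓ, d_m, m_ℓ, m_m > 0 with ⟨z, (D_•(t) + K_{•d}) z⟩ ≥ d_• ‖z‖² and ⟨z, M_•(t)⁻¹ z⟩ ≥ m_• ‖z‖² for all z and t. Set β := min{β_ℓ, β_m, d_ℓ m_ℓ, d_m m_m}. Then the differential storage function V(t) := (1/2)[⟨δq_ℓ, Π_ℓ δq_ℓ⟩ + ⟨δσ_ℓ, M_ℓ⁻¹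 δσ_ℓ⟩ + ⟨δq_m, Π_m δq_m⟩ + ⟨δσ_m, M_m⁻¹ δσ_m⟩](t) satisfies V(t) ≤ e^{−2β(t−t₀)} V(t₀) for all t ≥ t₀. -/
open Matrix

section QuadraticForms

variable {ι : Type*} [Fintype ι]

theorem hasDerivAt_quadratic_form {P : ℝ → Matrix ι ι ℝ} {P' : Matrix ι ι ℝ}
    {q : ℝ → ι → ℝ} {q' : ι → ℝ} {t : ℝ}
    (hP : ∀ i j, HasDerivAt (fun s => P s i j) (P' i j) t) (hq : HasDerivAt q q' t) :
    HasDerivAt (fun s => q s ⬝ᵥ (P s).mulVec (q s))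
      (q' ⬝ᵥ (P t).mulVec (q t) + q t ⬝ᵥ P'.mulVec (q t) + q t ⬝ᵥ (P t).mulVec q') t := by
  rw [hasDerivAt_pi] at hq
  have h : HasDerivAt (fun s => ∑ i, q s i * ∑ j, P s i j * q s j)
      (∑ i, (q' i * ∑ j, P t i j * q t j
        + q t i * ∑ j, (P' i j * q t j + P t i j * q' j))) t :=
    HasDerivAt.fun_sum fun i _ => (hq i).mul
      (HasDerivAt.fun_sum fun j _ => (hP i j).mul (hq j))
  refine h.congr_deriv ?_
  simp only [dotProduct, Matrix.mulVec, Finset.sum_add_distrib, mul_add, add_assoc]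

theorem dotProduct_mulVec_comm_of_transpose_eq_s11 {P : Matrix ι ι ℝ} (hP : Pᵀ = P) (x y : ι → ℝ) :
    x ⬝ᵥ P.mulVec y = y ⬝ᵥ P.mulVec x := by
  rw [dotProduct_mulVec, ← mulVec_transpose, hP, dotProduct_comm]

theorem dotProduct_mulVec_self_of_transpose_eq_neg {S : Matrix ι ι ℝ} (hS : Sᵀ = -S)
    (x : ι → ℝ) : x ⬝ᵥ S.mulVec x = 0 := by
  have h : x ⬝ᵥ S.mulVec x = -(x ⬝ᵥ S.mulVec x) := by
    conv_lhs => rw [dotProduct_mulVec, ← mulVec_transpose, hS, dotProduct_comm]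
    rw [neg_mulVec, dotProduct_neg]
  linarith

theorem dotProduct_mulVec_self_nonneg {P : Matrix ι ι ℝ}
    (hP : ∀ z : ι → ℝ, z ≠ 0 → 0 < z ⬝ᵥ P.mulVec z) (x : ι → ℝ) : 0 ≤ x ⬝ᵥ P.mulVec x := by
  rcases eq_or_ne x 0 with rfl | hx
  · simp
  · exact (hP x hx).le

theorem mul_dotProduct_le_dotProduct_self {m : ℝ} (hm : 0 < m) {x y : ι → ℝ}
    (h : m * (x ⬝ᵥ x) ≤ x ⬝ᵥ y) : m * (x ⬝ᵥ y) ≤ y ⬝ᵥ y := by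
  have hsq : 0 ≤ (y - m • x) ⬝ᵥ (y - m • x) :=
    Finset.sum_nonneg fun i _ => mul_self_nonneg _
  simp only [dotProduct_sub, sub_dotProduct, dotProduct_smul, smul_dotProduct, smul_eq_mul,
    dotProduct_comm y x] at hsq
  nlinarith [mul_le_mul_of_nonneg_left h hm.le]

theorem EuclideanSpace.norm_toLp_sq_eq_dotProduct (x : ι → ℝ) :
    ‖(WithLp.toLp 2 x : EuclideanSpace ℝ ι)‖ ^ 2 = x ⬝ᵥ x := by
  rw [EuclideanSpace.real_norm_sq_eq]
  simp only [dotProduct, sq]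

/-- Time derivative of the position storage along `q' = -A q + r`. -/
theorem hasDerivAt_position_storage {P : ℝ → Matrix ι ι ℝ} {P' A : Matrix ι ι ℝ}
    {q : ℝ → ι → ℝ} {r : ι → ℝ} {t : ℝ}
    (hP : ∀ i j, HasDerivAt (fun s => P s i j) (P' i j) t) (hsymm : (P t)ᵀ = P t)
    (hq : HasDerivAt q (-A.mulVec (q t) + r) t) :
    HasDerivAt (fun s => (1 / 2 : ℝ) * (q s ⬝ᵥ (P s).mulVec (q s)))
      ((1 / 2 : ℝ) * (q t ⬝ᵥ (P' - P t * A - Aᵀ * P t).mulVec (q t))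
        + r ⬝ᵥ (P t).mulVec (q t)) t := by
  refine ((hasDerivAt_quadratic_form hP hq).const_mul (1 / 2 : ℝ)).congr_deriv ?_
  have hA : q t ⬝ᵥ (Aᵀ * P t).mulVec (q t) = A.mulVec (q t) ⬝ᵥ (P t).mulVec (q t) := by
    rw [← mulVec_mulVec, dotProduct_mulVec, vecMul_transpose]
  rw [dotProduct_mulVec_comm_of_transpose_eq_s11 hsymm (q t) (-A.mulVec (q t) + r)]
  have hA' : q t ⬝ᵥ (P t * A).mulVec (q t) = A.mulVec (q t) ⬝ᵥ (P t).mulVec (q t) := by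
    rw [← mulVec_mulVec, dotProduct_mulVec_comm_of_transpose_eq_s11 hsymm]
  simp only [sub_mulVec, dotProduct_sub, add_dotProduct, neg_dotProduct, hA, hA']
  ring

variable [DecidableEq ι]

theorem Matrix.isUnit_of_dotProduct_mulVec_pos {P : Matrix ι ι ℝ}
    (hP : ∀ z : ι → ℝ, z ≠ 0 → 0 < z ⬝ᵥ P.mulVec z) : IsUnit P := by
  rw [← Matrix.mulVec_injective_iff_isUnit]
  intro x y hxy
  by_contra hne
  have h := hP (x - y) (sub_ne_zero.mpr hne)
  rw [mulVec_sub, sub_eq_zero.mpr hxy, dotProduct_zero] at h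
  exact lt_irrefl _ h

open scoped Matrix.Norms.Operator in
theorem Matrix.hasDerivAt_inv_apply {M : ℝ → Matrix ι ι ℝ} {M' : Matrix ι ι ℝ} {t : ℝ}
    (hM : ∀ i j, HasDerivAt (fun s => M s i j) (M' i j) t) (hu : IsUnit (M t)) (i j : ι) :
    HasDerivAt (fun s => (M s)⁻¹ i j) ((-((M t)⁻¹ * M' * (M t)⁻¹)) i j) t := by
  have hM₁ : HasDerivAt M M' t := hasDerivAt_pi.mpr fun i => hasDerivAt_pi.mpr fun j => hM i j
  obtain ⟨u, hu⟩ := hu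
  have hinv : HasFDerivAt Ring.inverse (-ContinuousLinearMap.mulLeftRight ℝ _ ↑u⁻¹ ↑u⁻¹) (M t) :=
    hu ▸ hasFDerivAt_ringInverse (𝕜 := ℝ) u
  have h := hinv.comp_hasDerivAt t hM₁
  have h' := hasDerivAt_pi.mp (hasDerivAt_pi.mp h i) j
  simpa [Function.comp_def, ← Matrix.nonsing_inv_eq_ringInverse, ← hu, Matrix.coe_units_inv] using h'

theorem hasDerivAt_inv_quadratic_form {M : ℝ → Matrix ι ι ℝ} {M' : Matrix ι ι ℝ}
    {σ : ℝ → ι → ℝ} {σ' : ι → ℝ} {t : ℝ}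
    (hM : ∀ i j, HasDerivAt (fun s => M s i j) (M' i j) t) (hu : IsUnit (M t))
    (hsymm : (M t)ᵀ = M t) (hσ : HasDerivAt σ σ' t) :
    HasDerivAt (fun s => σ s ⬝ᵥ (M s)⁻¹.mulVec (σ s))
      (2 * ((M t)⁻¹.mulVec (σ t) ⬝ᵥ σ')
        - (M t)⁻¹.mulVec (σ t) ⬝ᵥ M'.mulVec ((M t)⁻¹.mulVec (σ t))) t := by
  have hsymm_inv : ((M t)⁻¹)ᵀ = (M t)⁻¹ := by rw [transpose_nonsing_inv, hsymm]
  refine (hasDerivAt_quadratic_form (Matrix.hasDerivAt_inv_apply hM hu) hσ).congr_deriv ?_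
  rw [dotProduct_mulVec_comm_of_transpose_eq_s11 hsymm_inv (σ t) σ', neg_mulVec, dotProduct_neg,
    ← mulVec_mulVec, ← mulVec_mulVec, dotProduct_mulVec (σ t), ← mulVec_transpose, hsymm_inv,
    dotProduct_comm σ']
  ring

/-- Time derivative of the momentum storage along `σ' = r - (S - M'/2 + D + B) M⁻¹ σ`,
with `S` skew-symmetric: the gyroscopic and inertial terms cancel. -/
theorem hasDerivAt_momentum_storage {M : ℝ → Matrix ι ι ℝ} {M' S D B : Matrix ι ι ℝ}
    {σ : ℝ → ι → ℝ} {r : ι → ℝ} {t : ℝ}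
    (hM : ∀ i j, HasDerivAt (fun s => M s i j) (M' i j) t) (hu : IsUnit (M t))
    (hsymm : (M t)ᵀ = M t) (hS : Sᵀ = -S)
    (hσ : HasDerivAt σ
      (r - (S - (1 / 2 : ℝ) • M' + D + B).mulVec ((M t)⁻¹.mulVec (σ t))) t) :
    HasDerivAt (fun s => (1 / 2 : ℝ) * (σ s ⬝ᵥ (M s)⁻¹.mulVec (σ s)))
      ((M t)⁻¹.mulVec (σ t) ⬝ᵥ r
        - (M t)⁻¹.mulVec (σ t) ⬝ᵥ (D + B).mulVec ((M t)⁻¹.mulVec (σ t))) t := by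
  refine ((hasDerivAt_inv_quadratic_form hM hu hsymm hσ).const_mul (1 / 2 : ℝ)).congr_deriv ?_
  simp only [dotProduct_sub, add_mulVec, sub_mulVec, smul_mulVec, dotProduct_add,
    dotProduct_smul, smul_eq_mul, dotProduct_mulVec_self_of_transpose_eq_neg hS]
  ring

end QuadraticForms

/-- Damping dominates the momentum storage: `u ⬝ᵥ C u ≥ d m (σ ⬝ᵥ N σ)` for `u = N σ`. -/
theorem mul_dotProduct_mulVec_le_damping {n : ℕ} {N C : Matrix (Fin n) (Fin n) ℝ} {d m : ℝ}
    (hd : 0 < d) (hm : 0 < m)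
    (hC : ∀ z : EuclideanSpace ℝ (Fin n), d * ‖z‖ ^ 2 ≤ z ⬝ᵥ C.mulVec z)
    (hN : ∀ z : EuclideanSpace ℝ (Fin n), m * ‖z‖ ^ 2 ≤ z ⬝ᵥ N.mulVec z) (σ : Fin n → ℝ) :
    0 ≤ σ ⬝ᵥ N.mulVec σ ∧
      d * m * (σ ⬝ᵥ N.mulVec σ) ≤ N.mulVec σ ⬝ᵥ C.mulVec (N.mulVec σ) := by
  have hNσ := hN (WithLp.toLp 2 σ)
  have hCu := hC (WithLp.toLp 2 (N.mulVec σ))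
  refine ⟨le_trans (by positivity) hNσ, ?_⟩
  rw [EuclideanSpace.norm_toLp_sq_eq_dotProduct] at hNσ hCu
  calc d * m * (σ ⬝ᵥ N.mulVec σ) = d * (m * (σ ⬝ᵥ N.mulVec σ)) := by ring
    _ ≤ d * (N.mulVec σ ⬝ᵥ N.mulVec σ) :=
        mul_le_mul_of_nonneg_left (mul_dotProduct_le_dotProduct_self hm hNσ) hd.le
    _ ≤ _ := hCu

theorem le_exp_mul_of_hasDerivAt_le {V V' : ℝ → ℝ} {c : ℝ}
    (hV : ∀ t, HasDerivAt V (V' t) t) (hle : ∀ t, V' t ≤ c * V t) {a t : ℝ} (hat : a ≤ t) :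
    V t ≤ Real.exp (c * (t - a)) * V a := by
  have hderiv : ∀ s, HasDerivAt (fun s => Real.exp (-(c * (s - a))) * V s)
      (Real.exp (-(c * (s - a))) * (V' s - c * V s)) s := fun s => by
    have hlin : HasDerivAt (fun s => -(c * (s - a))) (-(c * 1)) s :=
      (((hasDerivAt_id s).sub_const a).const_mul c).neg
    refine (hlin.exp.mul (hV s)).congr_deriv ?_
    ring
  have hanti := antitone_of_hasDerivAt_nonpos hderiv
    (fun s => mul_nonpos_of_nonneg_of_nonpos (Real.exp_pos _).le (sub_nonpos.mpr (hle s))) hat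
  simp only [sub_self, mul_zero, neg_zero, Real.exp_zero, one_mul] at hanti
  calc V t = Real.exp (c * (t - a)) * (Real.exp (-(c * (t - a))) * V t) := by
        rw [← mul_assoc, ← Real.exp_add, add_neg_cancel, Real.exp_zero, one_mul]
    _ ≤ _ := mul_le_mul_of_nonneg_left hanti (Real.exp_pos _).le

/-- Corollary 2: exponential tracking rate for the flexible-joint robot. Under the strict
contraction hypotheses, the differential storage function decays as
`V(t) ≤ e^{−2β(t−t₀)}V(t₀)` with rate `β = min{β_ℓ, β_m, d_ℓ m_ℓ, d_m m_m}`. -/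
theorem stmt_11 (n : ℕ) (t₀ : ℝ)
    (Ml Ml' Mm Mm' : ℝ → Matrix (Fin n) (Fin n) ℝ)
    (hMldiff : ∀ t i j, HasDerivAt (fun s => Ml s i j) (Ml' t i j) t)
    (hMmdiff : ∀ t i j, HasDerivAt (fun s => Mm s i j) (Mm' t i j) t)
    (hMlsymm : ∀ t, (Ml t)ᵀ = Ml t) (hMmsymm : ∀ t, (Mm t)ᵀ = Mm t)
    (hMlpos : ∀ t (z : Fin n → ℝ), z ≠ 0 → 0 < z ⬝ᵥ (Ml t).mulVec z)
    (hMmpos : ∀ t (z : Fin n → ℝ), z ≠ 0 → 0 < z ⬝ᵥ (Mm t).mulVec z)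
    (Sl Sm : ℝ → Matrix (Fin n) (Fin n) ℝ)
    (hSl : ∀ t, (Sl t)ᵀ = -(Sl t)) (hSm : ∀ t, (Sm t)ᵀ = -(Sm t))
    (Dl Dm : ℝ → Matrix (Fin n) (Fin n) ℝ)
    (hDlsymm : ∀ t, (Dl t)ᵀ = Dl t) (hDmsymm : ∀ t, (Dm t)ᵀ = Dm t)
    (hDlpos : ∀ t (z : Fin n → ℝ), 0 ≤ z ⬝ᵥ (Dl t).mulVec z)
    (hDmpos : ∀ t (z : Fin n → ℝ), 0 ≤ z ⬝ᵥ (Dm t).mulVec z)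
    (Kld Kmd : Matrix (Fin n) (Fin n) ℝ)
    (hKldsymm : Kldᵀ = Kld) (hKmdsymm : Kmdᵀ = Kmd)
    (hKldpos : ∀ z : Fin n → ℝ, 0 ≤ z ⬝ᵥ Kld.mulVec z)
    (hKmdpos : ∀ z : Fin n → ℝ, 0 ≤ z ⬝ᵥ Kmd.mulVec z)
    (Pl Pl' Pm Pm' : ℝ → Matrix (Fin n) (Fin n) ℝ)
    (hPldiff : ∀ t i j, HasDerivAt (fun s => Pl s i j) (Pl' t i j) t)
    (hPmdiff : ∀ t i j, HasDerivAt (fun s => Pm s i j) (Pm' t i j) t)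
    (hPlsymm : ∀ t, (Pl t)ᵀ = Pl t) (hPmsymm : ∀ t, (Pm t)ᵀ = Pm t)
    (hPlpos : ∀ t (z : Fin n → ℝ), z ≠ 0 → 0 < z ⬝ᵥ (Pl t).mulVec z)
    (hPmpos : ∀ t (z : Fin n → ℝ), z ≠ 0 → 0 < z ⬝ᵥ (Pm t).mulVec z)
    (Al Am : ℝ → Matrix (Fin n) (Fin n) ℝ)
    (βl βm : ℝ) (hβl : 0 < βl) (hβm : 0 < βm)
    (hAl : ∀ t (z : Fin n → ℝ),
      z ⬝ᵥ (Pl' t - Pl t * Al t - (Al t)ᵀ * Pl t).mulVec z ≤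
        -(2 * βl) * (z ⬝ᵥ (Pl t).mulVec z))
    (hAm : ∀ t (z : Fin n → ℝ),
      z ⬝ᵥ (Pm' t - Pm t * Am t - (Am t)ᵀ * Pm t).mulVec z ≤
        -(2 * βm) * (z ⬝ᵥ (Pm t).mulVec z))
    (dl dm ml mm : ℝ) (hdl : 0 < dl) (hdm : 0 < dm) (hml : 0 < ml) (hmm : 0 < mm)
    (hDKl : ∀ t (z : EuclideanSpace ℝ (Fin n)), dl * ‖z‖ ^ 2 ≤ z ⬝ᵥ (Dl t + Kld).mulVec z)
    (hDKm : ∀ t (z : EuclideanSpace ℝ (Fin n)), dm * ‖z‖ ^ 2 ≤ z ⬝ᵥ (Dm t + Kmd).mulVec z)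
    (hMlinv : ∀ t (z : EuclideanSpace ℝ (Fin n)), ml * ‖z‖ ^ 2 ≤ z ⬝ᵥ (Ml t)⁻¹.mulVec z)
    (hMminv : ∀ t (z : EuclideanSpace ℝ (Fin n)), mm * ‖z‖ ^ 2 ≤ z ⬝ᵥ (Mm t)⁻¹.mulVec z)
    (K : Matrix (Fin n) (Fin n) ℝ)
    (δql δqm δσl δσm : ℝ → Fin n → ℝ)
    (hδql : ∀ t, HasDerivAt δql (-(Al t).mulVec (δql t) + (Ml t)⁻¹.mulVec (δσl t)) t)
    (hδqm : ∀ t, HasDerivAt δqm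
      (-(Am t).mulVec (δqm t) - (Pm t)⁻¹.mulVec (Kᵀ.mulVec ((Ml t)⁻¹.mulVec (δσl t)))
        + (Mm t)⁻¹.mulVec (δσm t)) t)
    (hδσl : ∀ t, HasDerivAt δσl
      (-(Pl t).mulVec (δql t) + K.mulVec (δqm t)
        - (Sl t - (1 / 2 : ℝ) • Ml' t + Dl t + Kld).mulVec ((Ml t)⁻¹.mulVec (δσl t))) t)
    (hδσm : ∀ t, HasDerivAt δσm
      (-(Pm t).mulVec (δqm t)
        - (Sm t - (1 / 2 : ℝ) • Mm' t + Dm t + Kmd).mulVec ((Mm t)⁻¹.mulVec (δσm t))) t)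
    (β : ℝ) (hβ : β = min (min βl βm) (min (dl * ml) (dm * mm)))
    (V : ℝ → ℝ)
    (hV : V = fun t => (1 / 2 : ℝ) * (δql t ⬝ᵥ (Pl t).mulVec (δql t))
      + (1 / 2 : ℝ) * (δσl t ⬝ᵥ (Ml t)⁻¹.mulVec (δσl t))
      + (1 / 2 : ℝ) * (δqm t ⬝ᵥ (Pm t).mulVec (δqm t))
      + (1 / 2 : ℝ) * (δσm t ⬝ᵥ (Mm t)⁻¹.mulVec (δσm t))) :
    ∀ t, t₀ ≤ t → V t ≤ Real.exp (-(2 * β) * (t - t₀)) * V t₀ := by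
  intro t ht
  have hql := fun t => hasDerivAt_position_storage (hPldiff t) (hPlsymm t) (hδql t)
  have hqm := fun t => hasDerivAt_position_storage (hPmdiff t) (hPmsymm t)
    ((hδqm t).congr_deriv (by rw [sub_eq_add_neg, add_assoc]))
  have hσl := fun t => hasDerivAt_momentum_storage (hMldiff t)
    (Matrix.isUnit_of_dotProduct_mulVec_pos (hMlpos t)) (hMlsymm t) (hSl t) (hδσl t)
  have hσm := fun t => hasDerivAt_momentum_storage (hMmdiff t)
    (Matrix.isUnit_of_dotProduct_mulVec_pos (hMmpos t)) (hMmsymm t) (hSm t) (hδσm t)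
  have hVderiv := fun t => (((hql t).add (hσl t)).add (hqm t)).add (hσm t)
  subst hV
  refine le_exp_mul_of_hasDerivAt_le hVderiv (fun s => ?_) ht
  have hPinv : (Pm s).mulVec ((Pm s)⁻¹.mulVec (Kᵀ.mulVec ((Ml s)⁻¹.mulVec (δσl s))))
      = Kᵀ.mulVec ((Ml s)⁻¹.mulVec (δσl s)) := by
    rw [mulVec_mulVec, Matrix.mul_nonsing_inv _ ((Matrix.isUnit_iff_isUnit_det _).mp
      (Matrix.isUnit_of_dotProduct_mulVec_pos (hPmpos s))), one_mulVec]
  have hcouple : (Pm s)⁻¹.mulVec (Kᵀ.mulVec ((Ml s)⁻¹.mulVec (δσl s))) ⬝ᵥ (Pm s).mulVec (δqm s)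
      = (Ml s)⁻¹.mulVec (δσl s) ⬝ᵥ K.mulVec (δqm s) := by
    rw [dotProduct_mulVec_comm_of_transpose_eq_s11 (hPmsymm s), hPinv, mulVec_transpose,
      dotProduct_comm, ← dotProduct_mulVec]
  obtain ⟨hσl_nonneg, hσl_le⟩ :=
    mul_dotProduct_mulVec_le_damping hdl hml (hDKl s) (hMlinv s) (δσl s)
  obtain ⟨hσm_nonneg, hσm_le⟩ :=
    mul_dotProduct_mulVec_le_damping hdm hmm (hDKm s) (hMminv s) (δσm s)
  have hβ₁ : β ≤ βl := hβ ▸ (min_le_left _ _).trans (min_le_left _ _)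
  have hβ₂ : β ≤ βm := hβ ▸ (min_le_left _ _).trans (min_le_right _ _)
  have hβ₃ : β ≤ dl * ml := hβ ▸ (min_le_right _ _).trans (min_le_left _ _)
  have hβ₄ : β ≤ dm * mm := hβ ▸ (min_le_right _ _).trans (min_le_right _ _)
  have h₁ := mul_le_mul_of_nonneg_right hβ₁ (dotProduct_mulVec_self_nonneg (hPlpos s) (δql s))
  have h₂ := mul_le_mul_of_nonneg_right hβ₂ (dotProduct_mulVec_self_nonneg (hPmpos s) (δqm s))
  have h₃ := mul_le_mul_of_nonneg_right hβ₃ hσl_nonneg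
  have h₄ := mul_le_mul_of_nonneg_right hβ₄ hσm_nonneg
  have hAls := hAl s (δql s)
  have hAms := hAm s (δqm s)
  simp only [Pi.add_apply, add_dotProduct, neg_dotProduct, dotProduct_add, dotProduct_neg, hcouple]
  linarith
end

section
/- (Link error dynamics of the flexible-joint robot under the v-dPBC controller.) Let M_ℓ : ℝⁿ → (n×n real matrices) be C¹ with M_ℓ(x) invertible for all x, P_ℓ : ℝⁿ → ℝ be C¹, D_ℓ, E_ℓ : ℝ → (n×n real matrices), K_{ℓd} an n×n matrix, K an invertible n×n matrix, φ_ℓ, η_ℓ : ℝⁿ → ℝⁿ, and q_{ℓd} : ℝ → ℝⁿ a C² desired link trajectory. Let q_ℓ, p_ℓ, q_m : ℝ → ℝⁿ be differentiable; define q̃_ℓ(t) := q_ℓ(t) − q_{ℓd}(t), p_{ℓr}(t) := M_ℓ(q_ℓ(t)) (q_{ℓd}'(t) − φ_ℓ(q̃_ℓ(t))), σ_ℓ(t) := p_ℓ(t) − p_{ℓr}(t), the link control u_ℓ(t) := p_{ℓr}'(t) + ∇P_ℓ(q_ℓ(t)) + (E_ℓ(t) + D_ℓ(t)) M_ℓ(q_ℓ(t))⁻¹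 p_{ℓr}(t) − η_ℓ(q̃_ℓ(t)) − K_{ℓd} M_ℓ(q_ℓ(t))⁻¹ σ_ℓ(t), the motor position reference q_{md}(t) := q_ℓ(t) + K⁻¹ u_ℓ(t), and the motor position error q̃_m(t) := q_m(t) − q_{md}(t); assume p_{ℓr} is differentiable. Suppose the link dynamics satisfy, for all t, q_ℓ'(t) = M_ℓ(q_ℓ(t))⁻¹ p_ℓ(t) and p_ℓ'(t) = −∇P_ℓ(q_ℓ(t)) + K (q_m(t) − q_ℓ(t)) − (E_ℓ(t) + D_ℓ(t)) M_ℓ(q_ℓ(t))⁻¹ p_ℓ(t). Then for all t: q̃_ℓ'(t) = −φ_ℓ(q̃_ℓ(t)) + M_ℓ(q_ℓ(t))⁻¹ σ_ℓ(t) and σ_ℓ'(t) = −η_ℓ(q̃_ℓ(t)) − (E_ℓ(t) + D_ℓ(t) + K_{ℓd}) M_ℓ(q_ℓ(t))⁻¹ σ_ℓ(t) + K q̃_m(t). -/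
open Matrix

/-- Link error dynamics of the flexible-joint robot under the v-dPBC controller: treating
the ideal link control `u_ℓ` as a reference for the elastic torque via
`q_{md} = q_ℓ + K⁻¹u_ℓ`, the mismatch enters through the coupling term `K q̃_m`. -/
theorem stmt_12 (n : ℕ)
    (Ml : (Fin n → ℝ) → Matrix (Fin n) (Fin n) ℝ)
    (hMlC1 : ∀ i j, ContDiff ℝ 1 (fun x => Ml x i j)) (hMlinv : ∀ x, IsUnit (Ml x))
    (Pl : (Fin n → ℝ) → ℝ) (hPl : ContDiff ℝ 1 Pl)
    -- `gradPl` is the gradient of `Pl` w.r.t. the standard inner product: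
    (gradPl : (Fin n → ℝ) → (Fin n → ℝ))
    (hgradPl : ∀ x w, fderiv ℝ Pl x w = gradPl x ⬝ᵥ w)
    (Dl El : ℝ → Matrix (Fin n) (Fin n) ℝ) (Kld : Matrix (Fin n) (Fin n) ℝ)
    (K : Matrix (Fin n) (Fin n) ℝ) (hK : IsUnit K)
    (φl ηl : (Fin n → ℝ) → (Fin n → ℝ))
    (qld : ℝ → Fin n → ℝ) (hqld : ContDiff ℝ 2 qld)
    (ql pl qm : ℝ → Fin n → ℝ)
    (hql : Differentiable ℝ ql) (hpl : Differentiable ℝ pl) (hqm : Differentiable ℝ qm)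
    (qtil : ℝ → Fin n → ℝ) (hqtil : qtil = fun t => ql t - qld t)
    (plr : ℝ → Fin n → ℝ)
    (hplr : plr = fun t => (Ml (ql t)).mulVec (deriv qld t - φl (qtil t)))
    (hplrdiff : Differentiable ℝ plr)
    (σl : ℝ → Fin n → ℝ) (hσl : σl = fun t => pl t - plr t)
    (ul : ℝ → Fin n → ℝ)
    (hul : ul = fun t => deriv plr t + gradPl (ql t)
      + (El t + Dl t).mulVec ((Ml (ql t))⁻¹.mulVec (plr t))
      - ηl (qtil t) - Kld.mulVec ((Ml (ql t))⁻¹.mulVec (σl t)))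
    (qmd : ℝ → Fin n → ℝ) (hqmd : qmd = fun t => ql t + K⁻¹.mulVec (ul t))
    (qtilm : ℝ → Fin n → ℝ) (hqtilm : qtilm = fun t => qm t - qmd t)
    (hqldyn : ∀ t, HasDerivAt ql ((Ml (ql t))⁻¹.mulVec (pl t)) t)
    (hpldyn : ∀ t, HasDerivAt pl
      (-gradPl (ql t) + K.mulVec (qm t - ql t)
        - (El t + Dl t).mulVec ((Ml (ql t))⁻¹.mulVec (pl t))) t) :
    ∀ t, HasDerivAt qtil (-φl (qtil t) + (Ml (ql t))⁻¹.mulVec (σl t)) t ∧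
      HasDerivAt σl
        (-ηl (qtil t) - (El t + Dl t + Kld).mulVec ((Ml (ql t))⁻¹.mulVec (σl t))
          + K.mulVec (qtilm t)) t := by
  intro t
  have hMdet : IsUnit (Ml (ql t)).det := (isUnit_iff_isUnit_det _).1 (hMlinv _)
  have hKdet : IsUnit K.det := (isUnit_iff_isUnit_det _).1 hK
  have hσ : σl t = pl t - plr t := by rw [hσl]
  have hMplr : (Ml (ql t))⁻¹.mulVec (plr t) = deriv qld t - φl (qtil t) := by
    simp only [hplr]
    rw [mulVec_mulVec, nonsing_inv_mul _ hMdet, one_mulVec]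
  have hKm : K.mulVec (qtilm t) = K.mulVec (qm t - ql t) - ul t := by
    simp only [hqtilm, hqmd]
    rw [← sub_sub, mulVec_sub, mulVec_mulVec, mul_nonsing_inv _ hKdet, one_mulVec]
  constructor
  · have hqldt : HasDerivAt qld (deriv qld t) t :=
      (hqld.differentiable (by norm_num) t).hasDerivAt
    have hderiv : HasDerivAt qtil ((Ml (ql t))⁻¹.mulVec (pl t) - deriv qld t) t := by
      rw [hqtil]
      exact (hqldyn t).sub hqldt
    rw [hσ, mulVec_sub, hMplr]
    convert hderiv using 1
    abel
  · have hderiv : HasDerivAt σl (-gradPl (ql t) + K.mulVec (qm t - ql t)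
        - (El t + Dl t).mulVec ((Ml (ql t))⁻¹.mulVec (pl t)) - deriv plr t) t := by
      rw [hσl]
      exact (hpldyn t).sub (hplrdiff t).hasDerivAt
    have hu := congrFun hul t
    rw [hKm, hu, add_mulVec (El t + Dl t) Kld, hσ, mulVec_sub (Ml (ql t))⁻¹,
      mulVec_sub (El t + Dl t)]
    convert hderiv using 1
    abel
end

section
/- (Motor error dynamics of the flexible-joint robot under the v-dPBC controller of Proposition 1.) Let M_m : ℝⁿ → (n×n real matrices) be C¹ with M_m(x) invertible for all x; let D_m, E_m : ℝ → (n×n real matrices), K_{md} and K n×n matrices, Π_m an invertible n×n matrix (or matrix function of time), M_ℓ : ℝ → (n×n invertible matrices), φ_m, η_m : ℝⁿ → ℝⁿ, ω : ℝ → ℝⁿ, σ_ℓ : ℝ → ℝⁿ, and q_{md} : ℝ → ℝⁿ a C² motor reference trajectory. Let q_m, p_m, q_ℓ : ℝ → ℝⁿ be differentiable; define q̃_m(t) := q_m(t) − q_{md}(t), the auxiliary motor momentum reference p_{mr}(t) := M_m(q_m(t)) (q_{md}'(t) − φ_m(q̃_m(t)) − Π_m⁻¹ Kᵀ M_ℓ(t)⁻¹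 σ_ℓ(t)), and σ_m(t) := p_m(t) − p_{mr}(t); assume p_{mr} is differentiable. Suppose the motor dynamics satisfy, for all t, q_m'(t) = M_m(q_m(t))⁻¹ p_m(t) and p_m'(t) = −K (q_m(t) − q_ℓ(t)) − (E_m(t) + D_m(t)) M_m(q_m(t))⁻¹ p_m(t) + u(t), with the control law u(t) := p_{mr}'(t) + K (q_m(t) − q_ℓ(t)) + (E_m(t) + D_m(t)) M_m(q_m(t))⁻¹ p_{mr}(t) − η_m(q̃_m(t)) − K_{md} M_m(q_m(t))⁻¹ σ_m(t) + ω(t). Then for all t: q̃_m'(t) = −φ_m(q̃_m(t)) − Π_m⁻¹ Kᵀ M_ℓ(t)⁻¹ σ_ℓ(t) + M_m(q_m(t))⁻¹ σ_m(t) and σ_m'(t) = −η_m(q̃_m(t)) − (E_m(t) + D_m(t) + K_{md}) M_m(q_m(t))⁻¹ σ_m(t) + ω(t). -/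
open Matrix

/-- Motor error dynamics of the flexible-joint robot under the v-dPBC controller of
Proposition 1: with the auxiliary momentum reference `p_{mr}` (including the
power-preserving coupling term `−Π_m⁻¹KᵀM_ℓ⁻¹σ_ℓ`), the motor error coordinates satisfy
the stated closed-loop equations. -/
theorem stmt_13 (n : ℕ)
    (Mm : (Fin n → ℝ) → Matrix (Fin n) (Fin n) ℝ)
    (hMmC1 : ∀ i j, ContDiff ℝ 1 (fun x => Mm x i j)) (hMminv : ∀ x, IsUnit (Mm x))
    (Dm Em : ℝ → Matrix (Fin n) (Fin n) ℝ)
    (Kmd K : Matrix (Fin n) (Fin n) ℝ)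
    (Pmm : ℝ → Matrix (Fin n) (Fin n) ℝ) (hPmm : ∀ t, IsUnit (Pmm t))
    (Mlt : ℝ → Matrix (Fin n) (Fin n) ℝ) (hMlt : ∀ t, IsUnit (Mlt t))
    (φm ηm : (Fin n → ℝ) → (Fin n → ℝ)) (ω σl : ℝ → Fin n → ℝ)
    (qmd : ℝ → Fin n → ℝ) (hqmd : ContDiff ℝ 2 qmd)
    (qm pm ql : ℝ → Fin n → ℝ)
    (hqm : Differentiable ℝ qm) (hpm : Differentiable ℝ pm) (hql : Differentiable ℝ ql)
    (qtilm : ℝ → Fin n → ℝ) (hqtilm : qtilm = fun t => qm t - qmd t)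
    (pmr : ℝ → Fin n → ℝ)
    (hpmr : pmr = fun t => (Mm (qm t)).mulVec
      (deriv qmd t - φm (qtilm t)
        - (Pmm t)⁻¹.mulVec (Kᵀ.mulVec ((Mlt t)⁻¹.mulVec (σl t)))))
    (hpmrdiff : Differentiable ℝ pmr)
    (σm : ℝ → Fin n → ℝ) (hσm : σm = fun t => pm t - pmr t)
    (u : ℝ → Fin n → ℝ)
    (hu : u = fun t => deriv pmr t + K.mulVec (qm t - ql t)
      + (Em t + Dm t).mulVec ((Mm (qm t))⁻¹.mulVec (pmr t))
      - ηm (qtilm t) - Kmd.mulVec ((Mm (qm t))⁻¹.mulVec (σm t)) + ω t)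
    (hqmdyn : ∀ t, HasDerivAt qm ((Mm (qm t))⁻¹.mulVec (pm t)) t)
    (hpmdyn : ∀ t, HasDerivAt pm
      (-K.mulVec (qm t - ql t)
        - (Em t + Dm t).mulVec ((Mm (qm t))⁻¹.mulVec (pm t)) + u t) t) :
    ∀ t, HasDerivAt qtilm
        (-φm (qtilm t) - (Pmm t)⁻¹.mulVec (Kᵀ.mulVec ((Mlt t)⁻¹.mulVec (σl t)))
          + (Mm (qm t))⁻¹.mulVec (σm t)) t ∧
      HasDerivAt σm
        (-ηm (qtilm t) - (Em t + Dm t + Kmd).mulVec ((Mm (qm t))⁻¹.mulVec (σm t))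
          + ω t) t := by
  intro t
  have hdet : IsUnit (Mm (qm t)).det := (Matrix.isUnit_iff_isUnit_det _).mp (hMminv _)
  have hpmr_vel : (Mm (qm t))⁻¹.mulVec (pmr t) = deriv qmd t - φm (qtilm t)
      - (Pmm t)⁻¹.mulVec (Kᵀ.mulVec ((Mlt t)⁻¹.mulVec (σl t))) := by
    rw [hpmr, Matrix.mulVec_mulVec, Matrix.nonsing_inv_mul _ hdet, Matrix.one_mulVec]
  have hσm_vel : (Mm (qm t))⁻¹.mulVec (σm t)
      = (Mm (qm t))⁻¹.mulVec (pm t) - (Mm (qm t))⁻¹.mulVec (pmr t) := by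
    rw [hσm, Matrix.mulVec_sub]
  constructor
  · have hqmd' : HasDerivAt qmd (deriv qmd t) t :=
      (hqmd.differentiable (by norm_num) t).hasDerivAt
    have hqtilm' : HasDerivAt qtilm ((Mm (qm t))⁻¹.mulVec (pm t) - deriv qmd t) t := by
      rw [hqtilm]
      exact (hqmdyn t).sub hqmd'
    convert hqtilm' using 1
    rw [hσm_vel, hpmr_vel]
    abel
  · have hσm' : HasDerivAt σm (-K.mulVec (qm t - ql t)
        - (Em t + Dm t).mulVec ((Mm (qm t))⁻¹.mulVec (pm t)) + u t - deriv pmr t) t := by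
      rw [hσm]
      exact (hpmdyn t).sub (hpmrdiff t).hasDerivAt
    convert hσm' using 1
    rw [hu, Matrix.add_mulVec (Em t + Dm t) Kmd]
    simp only [hσm_vel, Matrix.mulVec_sub]
    abel
end
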